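/- For a (N, N-1) cut-and-projection method (dim F = 1) with Γ = π_F(ℤ^N) dense in F of rank N - k (equivalently E ∩ ℤ^N of rank k), the complexity exponent α of Theorem 1 equals d - k = N - 1 - k; i.e., p(n) grows like n^{N-1-k} up to multiplicative constants. -/

import Mathlib

open Pointwise

/-- The 1-norm on `ℝ^N`. -/
noncomputable def oneNorm {N : ℕ} (x : Fin N → ℝ) : ℝ := ∑ i, |x i|

/-- The lattice `ℤ^N` inside `ℝ^N`. -/
def intLattice (N : ℕ) : Set (Fin N → ℝ) :=
  Set.range (fun m : Fin N → ℤ => fun i => ((m i : ℝ)))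

/-- The lifted patch of size `n` with seed `x`: `Ã(x,n) = (x + ℤ^N) ∩ B(x,n) ∩ S`. -/
def liftedPatch {N : ℕ} (S : Set (Fin N → ℝ)) (n : ℕ) (x : Fin N → ℝ) :
    Set (Fin N → ℝ) :=
  {y | y - x ∈ intLattice N ∧ oneNorm (y - x) ≤ n ∧ y ∈ S}

/-- The set of patches of size `n` with seed in `K ∩ Reg_n`. -/
def patchSet {N : ℕ} (π : (Fin N → ℝ) →ₗ[ℝ] (Fin N → ℝ))
    (S K : Set (Fin N → ℝ)) (Reg : ℕ → Set (Fin N → ℝ)) (n : ℕ) :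
    Set (Set (Fin N → ℝ)) :=
  {P | ∃ x ∈ K ∩ Reg n, P = π '' liftedPatch S n x}

/-- The inclusion `ℤ^N → ℝ^N`. -/
def intIncl (N : ℕ) : (Fin N → ℤ) →+ (Fin N → ℝ) :=
  (Int.castAddHom ℝ).compLeft (Fin N)

@[simp] lemma intIncl_apply {N : ℕ} (m : Fin N → ℤ) (i : Fin N) :
    intIncl N m i = (m i : ℝ) := rfl

lemma intIncl_injective (N : ℕ) : Function.Injective (intIncl N) := fun m m' h => by
  ext i
  have := congrFun h i
  simpa using this

lemma intIncl_mem_intLattice {N : ℕ} (m : Fin N → ℤ) : intIncl N m ∈ intLattice N := ⟨m, rfl⟩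

section OneNorm

variable {N : ℕ}

lemma oneNorm_nonneg (x : Fin N → ℝ) : 0 ≤ oneNorm x :=
  Finset.sum_nonneg fun _ _ => abs_nonneg _

lemma oneNorm_zero : oneNorm (0 : Fin N → ℝ) = 0 := by simp [oneNorm]

lemma oneNorm_add_le (x y : Fin N → ℝ) : oneNorm (x + y) ≤ oneNorm x + oneNorm y := by
  unfold oneNorm
  rw [← Finset.sum_add_distrib]
  exact Finset.sum_le_sum fun i _ => abs_add_le _ _

lemma oneNorm_smul (c : ℝ) (x : Fin N → ℝ) : oneNorm (c • x) = |c| * oneNorm x := by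
  simp [oneNorm, abs_mul, Finset.mul_sum]

lemma oneNorm_neg (x : Fin N → ℝ) : oneNorm (-x) = oneNorm x := by
  simp [oneNorm]

lemma oneNorm_sum_le {α : Type*} (s : Finset α) (x : α → Fin N → ℝ) :
    oneNorm (∑ j ∈ s, x j) ≤ ∑ j ∈ s, oneNorm (x j) :=
  Finset.le_sum_of_subadditive oneNorm oneNorm_zero.le oneNorm_add_le s x

lemma oneNorm_intIncl_zsmul (c : ℤ) (m : Fin N → ℤ) :
    oneNorm (intIncl N (c • m)) = |(c : ℝ)| * oneNorm (intIncl N m) := by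
  rw [← oneNorm_smul]
  congr 1
  ext i
  simp

lemma abs_apply_le_oneNorm (x : Fin N → ℝ) (i : Fin N) : |x i| ≤ oneNorm x :=
  Finset.single_le_sum (f := fun i => |x i|) (fun _ _ => abs_nonneg _) (Finset.mem_univ i)

lemma finite_intIncl_oneNorm_le (R : ℝ) :
    {m : Fin N → ℤ | oneNorm (intIncl N m) ≤ R}.Finite := by
  refine (Set.finite_Icc (fun _ => -⌈R⌉) (fun _ => ⌈R⌉)).subset fun m hm => ?_
  have h : ∀ i, |m i| ≤ ⌈R⌉ := fun i => by
    have h1 : |((m i : ℤ) : ℝ)| ≤ R := (abs_apply_le_oneNorm (intIncl N m) i).trans hm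
    exact_mod_cast h1.trans (Int.le_ceil R)
  exact ⟨fun i => (abs_le.1 (h i)).1, fun i => (abs_le.1 (h i)).2⟩

lemma exists_abs_linearMap_le (f : (Fin N → ℝ) →ₗ[ℝ] ℝ) :
    ∃ C : ℝ, 0 ≤ C ∧ ∀ x, |f x| ≤ C * oneNorm x := by
  refine ⟨∑ i, |f (fun j => if i = j then 1 else 0)|,
    Finset.sum_nonneg fun _ _ => abs_nonneg _, fun x => ?_⟩
  rw [LinearMap.pi_apply_eq_sum_univ f x, Finset.sum_mul]
  refine (Finset.abs_sum_le_sum_abs _ _).trans (Finset.sum_le_sum fun i _ => ?_)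
  rw [smul_eq_mul, abs_mul, mul_comm]
  exact mul_le_mul_of_nonneg_left (abs_apply_le_oneNorm x i) (abs_nonneg _)

lemma exists_abs_intHom_le (g : (Fin N → ℤ) →+ ℤ) :
    ∃ C : ℕ, ∀ m, |(g m : ℝ)| ≤ C * oneNorm (intIncl N m) := by
  refine ⟨∑ i, (g (fun j => if i = j then 1 else 0)).natAbs, fun m => ?_⟩
  have h : g m = ∑ i, m i • g (fun j => if i = j then 1 else 0) :=
    LinearMap.pi_apply_eq_sum_univ g.toIntLinearMap m
  rw [h]
  push_cast
  rw [Finset.sum_mul]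
  refine (Finset.abs_sum_le_sum_abs _ _).trans (Finset.sum_le_sum fun i _ => ?_)
  rw [smul_eq_mul, Int.cast_mul, abs_mul, mul_comm, Nat.cast_natAbs, Int.cast_abs]
  exact mul_le_mul_of_nonneg_left (abs_apply_le_oneNorm (intIncl N m) i) (abs_nonneg _)

end OneNorm

section Counting

variable {N : ℕ}

/-- The values of `φ` on the integer points of the ball of radius `n`. -/
def ballValues (φ : (Fin N → ℤ) →+ ℝ) (n : ℕ) : Set ℝ :=
  φ '' {m | oneNorm (intIncl N m) ≤ n}

lemma finite_ballValues (φ : (Fin N → ℤ) →+ ℝ) (n : ℕ) : (ballValues φ n).Finite :=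
  (finite_intIncl_oneNorm_le _).image _

lemma exists_basis_range {q : ℕ} (φ : (Fin N → ℤ) →+ ℝ)
    (hr : Module.finrank ℤ φ.range = q + 1) :
    Nonempty (Module.Basis (Fin (q + 1)) ℤ φ.range) := by
  have : Module.Finite ℤ φ.range :=
    Module.Finite.of_surjective φ.rangeRestrict.toIntLinearMap φ.rangeRestrict_surjective
  exact ⟨Module.finBasisOfFinrankEq ℤ φ.range hr⟩

lemma ncard_ballValues_inter_Ioo_le {q : ℕ} (φ : (Fin N → ℤ) →+ ℝ)
    (hr : Module.finrank ℤ φ.range = q + 1) (w : ℝ) :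
    ∃ C : ℕ, ∀ n : ℕ, 1 ≤ n → (ballValues φ n ∩ Set.Ioo (-w) w).ncard ≤ C * n ^ q := by
  obtain ⟨b⟩ := exists_basis_range φ hr
  choose B hB using fun j =>
    exists_abs_intHom_le ((b.coord j).toAddMonoidHom.comp φ.rangeRestrict)
  have hY : ∀ u : ℝ, ∃ y : φ.range, u ∈ φ.range → (y : ℝ) = u := fun u => by
    by_cases hu : u ∈ φ.range
    · exact ⟨⟨u, hu⟩, fun _ => rfl⟩
    · exact ⟨0, fun h => absurd h hu⟩
  choose Y hY using hY
  set γ : ℝ := |(b 0 : ℝ)| with hγ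
  have hγ0 : 0 < γ := abs_pos.2 fun h => b.ne_zero 0 (Subtype.ext h)
  set C : ℕ := ∑ j, B j
  let I : Finset ℤ := Finset.Icc ⌊-w / γ⌋ ⌊w / γ⌋
  refine ⟨(2 * C + 1) ^ q * I.card, fun n hn => ?_⟩
  let box : Finset ((Fin q → ℤ) × ℤ) :=
    (Fintype.piFinset fun _ => Finset.Icc (-((C * n : ℕ) : ℤ)) ((C * n : ℕ) : ℤ)) ×ˢ I
  let G : ℝ → (Fin q → ℤ) × ℤ := fun u => (fun j => b.repr (Y u) j.succ, ⌊u / γ⌋)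
  have hmaps : ∀ u ∈ ballValues φ n ∩ Set.Ioo (-w) w, G u ∈ (box : Set _) := by
    rintro u ⟨⟨m, hm, rfl⟩, hu⟩
    have hYm : Y (φ m) = φ.rangeRestrict m := Subtype.ext (hY _ ⟨m, rfl⟩)
    simp only [box, G, I, Finset.coe_product, Set.mem_prod, Finset.mem_coe,
      Fintype.mem_piFinset, Finset.mem_Icc]
    refine ⟨fun j => ?_, Int.floor_mono (by gcongr; exact hu.1.le),
      Int.floor_mono (by gcongr; exact hu.2.le)⟩
    rw [← abs_le, hYm]
    have h1 := hB j.succ m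
    have h2 : (B j.succ : ℝ) ≤ C := by
      exact_mod_cast Finset.single_le_sum (f := B) (fun _ _ => Nat.zero_le _)
        (Finset.mem_univ j.succ)
    have h3 : |((b.repr (φ.rangeRestrict m) j.succ : ℤ) : ℝ)| ≤ C * n :=
      h1.trans (mul_le_mul h2 hm (oneNorm_nonneg _) (Nat.cast_nonneg _))
    exact_mod_cast h3
  have hinj : Set.InjOn G (ballValues φ n ∩ Set.Ioo (-w) w) := by
    rintro u ⟨⟨m, -, rfl⟩, -⟩ v ⟨⟨m', -, rfl⟩, -⟩ h
    have hu := hY (φ m) ⟨m, rfl⟩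
    have hv := hY (φ m') ⟨m', rfl⟩
    have htail : ∀ j : Fin q, b.repr (Y (φ m)) j.succ = b.repr (Y (φ m')) j.succ :=
      fun j => congrFun (congrArg Prod.fst h) j
    have hfl : ⌊φ m / γ⌋ = ⌊φ m' / γ⌋ := congrArg Prod.snd h
    have hsum : ∀ y : φ.range, (y : ℝ) = b.repr y 0 * (b 0 : ℝ)
        + ∑ j : Fin q, (b.repr y j.succ) * (b j.succ : ℝ) := fun y => by
      conv_lhs => rw [← b.sum_repr y]
      rw [Fin.sum_univ_succ]
      simp
    have hdiff : φ m - φ m' =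
        ((b.repr (Y (φ m)) 0 - b.repr (Y (φ m')) 0 : ℤ) : ℝ) * (b 0 : ℝ) := by
      conv_lhs => rw [← hu, ← hv, hsum (Y (φ m)), hsum (Y (φ m'))]
      simp only [htail]
      push_cast
      ring
    have hlt : |φ m / γ - φ m' / γ| < 1 := Int.abs_sub_lt_one_of_floor_eq_floor hfl
    rw [← sub_div, abs_div, abs_of_pos hγ0, div_lt_one hγ0, hdiff, abs_mul, ← hγ] at hlt
    have h1 : |((b.repr (Y (φ m)) 0 - b.repr (Y (φ m')) 0 : ℤ) : ℝ)| < 1 := by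
      by_contra! hcon
      nlinarith
    have h2 : b.repr (Y (φ m)) 0 - b.repr (Y (φ m')) 0 = 0 :=
      Int.abs_lt_one_iff.1 (by exact_mod_cast h1)
    rw [h2] at hdiff
    simpa [sub_eq_zero] using hdiff
  calc (ballValues φ n ∩ Set.Ioo (-w) w).ncard
      ≤ (box : Set ((Fin q → ℤ) × ℤ)).ncard :=
        Set.ncard_le_ncard_of_injOn G hmaps hinj box.finite_toSet
    _ = (2 * (C * n) + 1) ^ q * I.card := by
        rw [Set.ncard_coe_finset, Finset.card_product, Fintype.card_piFinset]
        simp only [Int.card_Icc, Finset.prod_const, Finset.card_univ, Fintype.card_fin]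
        congr 2
        omega
    _ ≤ ((2 * C + 1) * n) ^ q * I.card := by
        gcongr
        nlinarith
    _ = (2 * C + 1) ^ q * I.card * n ^ q := by rw [mul_pow]; ring

lemma exists_pow_le_ncard_ballValues_inter_Ioc {q : ℕ} (φ : (Fin N → ℤ) →+ ℝ)
    (hr : Module.finrank ℤ φ.range = q + 1) {w : ℝ} (hw : ∃ g, 0 < φ g ∧ φ g < w) :
    ∃ A : ℕ, 0 < A ∧ ∀ M : ℕ, 1 ≤ M →
      M ^ q ≤ (ballValues φ (A * M) ∩ Set.Ioc (-w) 0).ncard := by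
  obtain ⟨b⟩ := exists_basis_range φ hr
  obtain ⟨g, hg0, hgw⟩ := hw
  obtain ⟨j₀, hj₀⟩ : ∃ j, b.repr (φ.rangeRestrict g) j ≠ 0 := by
    by_contra! h
    have h0 : φ.rangeRestrict g = 0 := b.repr.map_eq_zero_iff.1 (Finsupp.ext h)
    exact hg0.ne' (congrArg Subtype.val h0)
  choose e he using fun j => φ.rangeRestrict_surjective (b j)
  let v : (Fin q → ℕ) → (Fin N → ℤ) := fun c => ∑ j, (c j : ℤ) • e (j₀.succAbove j)
  let z : (Fin q → ℕ) → ℤ := fun c => -⌊φ (v c) / φ g⌋ - 1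
  let l : (Fin q → ℕ) → (Fin N → ℤ) := fun c => v c + z c • g
  have hl : ∀ c, φ (l c) = φ (v c) + z c * φ g := fun c => by
    rw [map_add, map_zsmul, zsmul_eq_mul]
  set D : ℝ := ∑ j, |φ (e (j₀.succAbove j))|
  set D' : ℝ := ∑ j, oneNorm (intIncl N (e (j₀.succAbove j)))
  set G : ℝ := oneNorm (intIncl N g)
  have hG : 0 ≤ G := oneNorm_nonneg _
  have hD : 0 ≤ D := Finset.sum_nonneg fun _ _ => abs_nonneg _
  have hD' : 0 ≤ D' := Finset.sum_nonneg fun _ _ => oneNorm_nonneg _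
  obtain ⟨A, hA⟩ := exists_nat_ge (D' + (D / φ g + 2) * G)
  refine ⟨A + 1, A.succ_pos, fun M hM => ?_⟩
  have hM' : (1 : ℝ) ≤ M := by exact_mod_cast hM
  let box : Finset (Fin q → ℕ) := Fintype.piFinset fun _ => Finset.range M
  have hbox : ∀ c ∈ box, ∀ j, (c j : ℝ) ≤ M := fun c hc j => by
    have := Finset.mem_range.1 (Fintype.mem_piFinset.1 hc j)
    exact_mod_cast this.le
  have hmaps : ∀ c ∈ (box : Set (Fin q → ℕ)),
      φ (l c) ∈ ballValues φ ((A + 1) * M) ∩ Set.Ioc (-w) 0 := by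
    intro c hc
    have hφv : |φ (v c)| ≤ D * M := by
      simp only [v, map_sum, D, Finset.sum_mul]
      refine (Finset.abs_sum_le_sum_abs _ _).trans (Finset.sum_le_sum fun j _ => ?_)
      rw [map_zsmul, zsmul_eq_mul, abs_mul, mul_comm]
      gcongr
      simpa using hbox c hc j
    have hnv : oneNorm (intIncl N (v c)) ≤ D' * M := by
      simp only [v, map_sum, D', Finset.sum_mul]
      refine (oneNorm_sum_le _ _).trans (Finset.sum_le_sum fun j _ => ?_)
      rw [oneNorm_intIncl_zsmul, mul_comm]
      gcongr
      · exact oneNorm_nonneg _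
      · simpa using hbox c hc j
    have hf1 := Int.floor_le (φ (v c) / φ g)
    have hf2 := Int.lt_floor_add_one (φ (v c) / φ g)
    have hzc : (z c : ℝ) = -(⌊φ (v c) / φ g⌋ : ℝ) - 1 := by simp [z]
    have hz : |(z c : ℝ)| ≤ (D / φ g + 2) * M := by
      have h1 : |φ (v c) / φ g| ≤ D / φ g * M := by
        rw [abs_div, abs_of_pos hg0, div_mul_eq_mul_div]
        gcongr
      rw [hzc]
      have h2 := abs_le.1 h1
      rw [abs_le]
      constructor <;> nlinarith
    refine ⟨⟨l c, ?_, rfl⟩, ?_⟩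
    · have h1 : oneNorm (intIncl N (l c)) ≤ D' * M + (D / φ g + 2) * M * G := by
        simp only [l, map_add]
        refine (oneNorm_add_le _ _).trans (add_le_add hnv ?_)
        rw [oneNorm_intIncl_zsmul]
        gcongr
      have h2 : D' * M + (D / φ g + 2) * M * G ≤ (A + 1) * M := by
        nlinarith
      simpa using h1.trans h2
    · rw [div_lt_iff₀ hg0] at hf2
      rw [le_div_iff₀ hg0] at hf1
      rw [hl, hzc]
      constructor <;> nlinarith
  have hinj : Set.InjOn (fun c => φ (l c)) (box : Set (Fin q → ℕ)) := by
    intro c _ c' _ h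
    have h' : φ.rangeRestrict (l c) = φ.rangeRestrict (l c') := Subtype.ext h
    have hcoord : ∀ c : Fin q → ℕ, ∀ i, b.repr (φ.rangeRestrict (l c)) i =
        (∑ j, if j₀.succAbove j = i then (c j : ℤ) else 0)
          + z c * b.repr (φ.rangeRestrict g) i := fun c i => by
      simp only [l, v, map_add, map_sum, map_zsmul, he]
      simp [Finsupp.single_apply]
    have hz : z c = z c' := by
      have h1 := hcoord c j₀
      rw [h', hcoord c' j₀] at h1
      simpa [Fin.succAbove_ne, hj₀] using h1.symm
    funext j
    have h1 := hcoord c (j₀.succAbove j)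
    rw [h', hcoord c' (j₀.succAbove j), hz] at h1
    simpa using h1.symm
  calc M ^ q = (box : Set (Fin q → ℕ)).ncard := by
        rw [Set.ncard_coe_finset, Fintype.card_piFinset]
        simp
    _ ≤ _ := Set.ncard_le_ncard_of_injOn _ hmaps hinj ((finite_ballValues φ _).inter_of_left _)

end Counting

section Slab

variable {N : ℕ}

/-- The integer points `m` of the ball of radius `n` with `s + φ m ∈ [a, b]`. -/
def slabPoints (φ : (Fin N → ℤ) →+ ℝ) (a b : ℝ) (n : ℕ) (s : ℝ) : Set (Fin N → ℤ) :=
  {m | oneNorm (intIncl N m) ≤ n ∧ s + φ m ∈ Set.Icc a b}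

/-- The parameters at which `slabPoints` may change. -/
def slabThresholds (φ : (Fin N → ℤ) →+ ℝ) (a b : ℝ) (n : ℕ) : Set ℝ :=
  {t | ∃ m, oneNorm (intIncl N m) ≤ n ∧ (t + φ m = a ∨ t + φ m = b)}

/-- The parameters in `[a, b]` at which `slabPoints` is locally constant. -/
def slabRegular (φ : (Fin N → ℤ) →+ ℝ) (a b : ℝ) (n : ℕ) : Set ℝ :=
  Set.Icc a b \ slabThresholds φ a b n

variable (φ : (Fin N → ℤ) →+ ℝ) {a b : ℝ} (n : ℕ)

lemma zero_mem_slabPoints {s : ℝ} (hs : s ∈ Set.Icc a b) : 0 ∈ slabPoints φ a b n s := by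
  refine ⟨?_, by simpa using hs⟩
  rw [map_zero, oneNorm_zero]
  exact n.cast_nonneg

lemma slabThresholds_subset : slabThresholds φ a b n ⊆
    (fun u => a - u) '' ballValues φ n ∪ (fun u => b - u) '' ballValues φ n := by
  rintro t ⟨m, hm, h | h⟩
  · exact Or.inl ⟨φ m, ⟨m, hm, rfl⟩, by simp [← h]⟩
  · exact Or.inr ⟨φ m, ⟨m, hm, rfl⟩, by simp [← h]⟩

lemma finite_slabThresholds : (slabThresholds φ a b n).Finite :=
  (((finite_ballValues φ n).image _).union ((finite_ballValues φ n).image _)).subset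
    (slabThresholds_subset φ n)

lemma ncard_slabThresholds_inter_Ioo_le :
    (slabThresholds φ a b n ∩ Set.Ioo a b).ncard ≤
      2 * (ballValues φ n ∩ Set.Ioo (-(b - a)) (b - a)).ncard := by
  set V := ballValues φ n ∩ Set.Ioo (-(b - a)) (b - a)
  have hV : V.Finite := (finite_ballValues φ n).inter_of_left _
  have hsub : slabThresholds φ a b n ∩ Set.Ioo a b ⊆
      (fun u => a - u) '' V ∪ (fun u => b - u) '' V := by
    rintro t ⟨⟨m, hm, h | h⟩, hta, htb⟩
    · exact Or.inl ⟨φ m, ⟨⟨m, hm, rfl⟩, by constructor <;> linarith⟩, by simp [← h]⟩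
    · exact Or.inr ⟨φ m, ⟨⟨m, hm, rfl⟩, by constructor <;> linarith⟩, by simp [← h]⟩
  calc _ ≤ ((fun u => a - u) '' V ∪ (fun u => b - u) '' V).ncard :=
        Set.ncard_le_ncard hsub ((hV.image _).union (hV.image _))
    _ ≤ ((fun u => a - u) '' V).ncard + ((fun u => b - u) '' V).ncard := Set.ncard_union_le _ _
    _ ≤ V.ncard + V.ncard := add_le_add (Set.ncard_image_le hV) (Set.ncard_image_le hV)
    _ = 2 * V.ncard := (two_mul _).symm

variable {n}

lemma slabPoints_eq_of_forall_notMem {s t : ℝ} (hs : s ∈ slabRegular φ a b n)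
    (ht : t ∈ slabRegular φ a b n) (hst : s ≤ t)
    (h : ∀ u ∈ Set.Ioo s t, u ∉ slabThresholds φ a b n) :
    slabPoints φ a b n s = slabPoints φ a b n t := by
  have key : ∀ u ∈ Set.Icc s t, u ∉ slabThresholds φ a b n := fun u hu hmem => by
    rcases hu.1.eq_or_lt with rfl | h1
    · exact hs.2 hmem
    rcases hu.2.eq_or_lt with rfl | h2
    · exact ht.2 hmem
    exact h u ⟨h1, h2⟩ hmem
  have hs1 := hs.1
  have ht1 := ht.1
  ext m
  refine and_congr_right fun hm => ⟨fun hms => ⟨by linarith [hms.1], ?_⟩,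
    fun hmt => ⟨?_, by linarith [hmt.2]⟩⟩
  · by_contra! hcon
    exact key (b - φ m) ⟨by linarith [hms.2], by linarith⟩ ⟨m, hm, Or.inr (by ring)⟩
  · by_contra! hcon
    exact key (a - φ m) ⟨by linarith, by linarith [hmt.1]⟩ ⟨m, hm, Or.inl (by ring)⟩

variable (n)

/-- The slabs of size `n` seen from regular parameters. -/
def slabs (φ : (Fin N → ℤ) →+ ℝ) (a b : ℝ) (n : ℕ) : Set (Set (Fin N → ℤ)) :=
  slabPoints φ a b n '' slabRegular φ a b n

lemma finite_slabs_and_ncard_le :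
    (slabs φ a b n).Finite ∧
      (slabs φ a b n).ncard ≤ (slabThresholds φ a b n ∩ Set.Ioo a b).ncard + 1 := by
  set T := slabThresholds φ a b n ∩ Set.Ioo a b
  have hT : T.Finite := (finite_slabThresholds φ n).inter_of_left _
  have hrep : ∀ P : Set (Fin N → ℤ), ∃ s, P ∈ slabs φ a b n →
      s ∈ slabRegular φ a b n ∧ slabPoints φ a b n s = P := fun P => by
    by_cases hP : P ∈ slabs φ a b n
    · obtain ⟨s, hs⟩ := hP
      exact ⟨s, fun _ => hs⟩
    · exact ⟨0, fun h => absurd h hP⟩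
  choose σ hσ using hrep
  let G : Set (Fin N → ℤ) → ℕ := fun P => (T ∩ Set.Iio (σ P)).ncard
  have hmaps : Set.MapsTo G (slabs φ a b n) (Set.Iio (T.ncard + 1)) := fun P _ =>
    Nat.lt_succ_of_le (Set.ncard_le_ncard Set.inter_subset_left hT)
  have hle : ∀ s ∈ slabRegular φ a b n, ∀ t ∈ slabRegular φ a b n, s ≤ t →
      (T ∩ Set.Iio s).ncard = (T ∩ Set.Iio t).ncard →
      slabPoints φ a b n s = slabPoints φ a b n t := by
    intro s hs t ht hst hcard
    refine slabPoints_eq_of_forall_notMem φ hs ht hst fun u hu hmem => ?_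
    have heq : T ∩ Set.Iio s = T ∩ Set.Iio t :=
      Set.eq_of_subset_of_ncard_le (Set.inter_subset_inter_right _ (Set.Iio_subset_Iio hst))
        hcard.ge (hT.inter_of_left _)
    have hu' : u ∈ T ∩ Set.Iio t :=
      ⟨⟨hmem, hs.1.1.trans_lt hu.1, hu.2.trans_le ht.1.2⟩, hu.2⟩
    rw [← heq] at hu'
    exact absurd hu'.2 (not_lt.2 hu.1.le)
  have hinj : Set.InjOn G (slabs φ a b n) := by
    intro P hP Q hQ hPQ
    obtain ⟨hP1, hP2⟩ := hσ P hP
    obtain ⟨hQ1, hQ2⟩ := hσ Q hQ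
    rw [← hP2, ← hQ2]
    rcases le_total (σ P) (σ Q) with h | h
    · exact hle _ hP1 _ hQ1 h hPQ
    · exact (hle _ hQ1 _ hP1 h hPQ.symm).symm
  have hfin : (Set.Iio (T.ncard + 1)).Finite := Set.finite_Iio _
  refine ⟨Set.Finite.of_injOn hmaps hinj hfin, ?_⟩
  refine (Set.ncard_le_ncard_of_injOn G hmaps hinj hfin).trans_eq ?_
  rw [← Finset.coe_Iio, Set.ncard_coe_finset, Nat.card_Iio]

lemma ncard_ballValues_inter_Ioc_le_ncard_slabs :
    (ballValues φ n ∩ Set.Ioc (-(b - a)) 0).ncard ≤ (slabs φ a b n).ncard := by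
  have hnext : ∀ t : ℝ, ∃ s, t < b → t < s ∧ s < b ∧
      ∀ u ∈ Set.Ioc t s, u ∉ slabThresholds φ a b n := fun t => by
    by_cases htb : t < b
    · obtain ⟨μ, hμ, hmin⟩ := Set.exists_min_image
        (insert b (slabThresholds φ a b n ∩ Set.Ioi t)) id
        (((finite_slabThresholds φ n).inter_of_left _).insert b) (Set.insert_nonempty _ _)
      have htμ : t < μ := by
        rcases hμ with rfl | hμ
        exacts [htb, hμ.2]
      have hμb : μ ≤ b := hmin b (Set.mem_insert _ _)
      refine ⟨(t + μ) / 2, fun _ => ⟨by linarith, by linarith, fun u hu hmem => ?_⟩⟩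
      have h1 : μ ≤ u := hmin u (Set.mem_insert_of_mem _ ⟨hmem, hu.1⟩)
      linarith [hu.2]
    · exact ⟨0, fun h => absurd h htb⟩
  choose σ hσ using hnext
  refine Set.ncard_le_ncard_of_injOn (fun u => slabPoints φ a b n (σ (a - u))) ?_ ?_
    (finite_slabs_and_ncard_le φ n).1
  · rintro u ⟨-, hu1, hu2⟩
    obtain ⟨h1, h2, h3⟩ := hσ (a - u) (by linarith)
    exact ⟨_, ⟨⟨by linarith, h2.le⟩, h3 _ ⟨h1, le_rfl⟩⟩, rfl⟩
  · have hlt : ∀ u ∈ ballValues φ n ∩ Set.Ioc (-(b - a)) 0,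
        ∀ v ∈ ballValues φ n ∩ Set.Ioc (-(b - a)) 0, u < v →
        slabPoints φ a b n (σ (a - u)) ≠ slabPoints φ a b n (σ (a - v)) := by
      rintro u ⟨⟨m, hm, rfl⟩, hu1, hu2⟩ v ⟨-, hv1, hv2⟩ huv heq
      obtain ⟨h1, h2, -⟩ := hσ (a - φ m) (by linarith)
      obtain ⟨k1, k2, k3⟩ := hσ (a - v) (by linarith)
      have hmem : m ∈ slabPoints φ a b n (σ (a - φ m)) :=
        ⟨hm, by linarith, by linarith⟩
      rw [heq] at hmem
      have hmem2 := hmem.2.1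
      exact k3 (a - φ m) ⟨by linarith, by linarith⟩ ⟨m, hm, Or.inl (by ring)⟩
    intro u hu v hv h
    by_contra hne
    rcases lt_or_gt_of_ne hne with h' | h'
    · exact hlt u hu v hv h' h
    · exact hlt v hv u hu h' h.symm

end Slab

section Translation

variable {N : ℕ}

lemma exists_bounded_mem_Icc (φ : (Fin N → ℤ) →+ ℝ) {w : ℝ} (hw : ∃ g, 0 < φ g ∧ φ g < w)
    (R : ℝ) : ∃ C : ℝ, 0 ≤ C ∧ ∀ t, |t| ≤ R →
      ∃ g, oneNorm (intIncl N g) ≤ C ∧ φ g ∈ Set.Icc t (t + w) := by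
  obtain ⟨g, hg0, hgw⟩ := hw
  have hG := oneNorm_nonneg (intIncl N g)
  refine ⟨(|R| / φ g + 1) * oneNorm (intIncl N g), by positivity, fun t ht => ?_⟩
  have h1 := Int.le_ceil (t / φ g)
  have h2 := Int.ceil_lt_add_one (t / φ g)
  refine ⟨⌈t / φ g⌉ • g, ?_, ?_⟩
  · rw [oneNorm_intIncl_zsmul]
    gcongr
    have h3 : |t / φ g| ≤ |R| / φ g := by
      rw [abs_div, abs_of_pos hg0]
      exact div_le_div_of_nonneg_right (ht.trans (le_abs_self R)) hg0.le
    have h4 := abs_le.1 h3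
    rw [abs_le]
    constructor <;> linarith
  · rw [map_zsmul, zsmul_eq_mul]
    rw [div_le_iff₀ hg0] at h1
    rw [← sub_lt_iff_lt_add, lt_div_iff₀ hg0] at h2
    constructor <;> linarith

lemma oneNorm_floor_sub_le (z : Fin N → ℝ) :
    oneNorm (intIncl N (fun i => ⌊z i⌋) - z) ≤ N := by
  calc oneNorm (intIncl N (fun i => ⌊z i⌋) - z) ≤ ∑ _i : Fin N, (1 : ℝ) :=
        Finset.sum_le_sum fun i _ => by
          have h1 := Int.floor_le (z i)
          have h2 := Int.lt_floor_add_one (z i)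
          simp only [Pi.sub_apply, intIncl_apply]
          rw [abs_le]
          constructor <;> linarith
    _ = N := by simp

lemma exists_near_mem_Icc (f : (Fin N → ℝ) →ₗ[ℝ] ℝ) {a b : ℝ}
    (hw : ∃ g, 0 < f (intIncl N g) ∧ f (intIncl N g) < b - a) :
    ∃ C : ℝ, 0 ≤ C ∧ ∀ z, f z = 0 → ∀ s ∈ Set.Icc a b,
      ∃ l, oneNorm (intIncl N l - z) ≤ C ∧ s + f (intIncl N l) ∈ Set.Icc a b := by
  obtain ⟨B, hB0, hB⟩ := exists_abs_linearMap_le f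
  obtain ⟨C, hC0, hC⟩ := exists_bounded_mem_Icc
    (f.toAddMonoidHom.comp (intIncl N)) hw ((b - a) + B * N)
  refine ⟨N + C, by positivity, fun z hz s hs => ?_⟩
  set l : Fin N → ℤ := fun i => ⌊z i⌋
  have hl := oneNorm_floor_sub_le z
  have hfl : |f (intIncl N l)| ≤ B * N := by
    have h1 := (hB _).trans (mul_le_mul_of_nonneg_left hl hB0)
    rwa [map_sub, hz, sub_zero] at h1
  have h2 := abs_le.1 hfl
  obtain ⟨g, hg, hg1, hg2⟩ := hC (a - s - f (intIncl N l)) (by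
    rw [abs_le]
    constructor <;> linarith [hs.1, hs.2])
  simp only [AddMonoidHom.coe_comp, LinearMap.toAddMonoidHom_coe, Function.comp_apply] at hg1 hg2
  refine ⟨l + g, ?_, ?_⟩
  · rw [map_add, add_sub_right_comm]
    exact (oneNorm_add_le _ _).trans (add_le_add hl hg)
  · rw [map_add, map_add]
    constructor <;> linarith

lemma exists_oneNorm_le_of_translate (f : (Fin N → ℝ) →ₗ[ℝ] ℝ) {u : Fin N → ℝ} (hu : f u = 1)
    {a b : ℝ} (hw : ∃ g, 0 < f (intIncl N g) ∧ f (intIncl N g) < b - a) :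
    ∃ R : ℝ, ∀ n : ℕ, ∀ s ∈ Set.Icc a b, ∀ t ∈ Set.Icc a b, ∀ l₀,
      (∀ l ∈ slabPoints (f.toAddMonoidHom.comp (intIncl N)) a b n s,
        l + l₀ ∈ slabPoints (f.toAddMonoidHom.comp (intIncl N)) a b n t) →
      oneNorm (intIncl N l₀) ≤ R := by
  obtain ⟨C, hC0, hC⟩ := exists_near_mem_Icc f hw
  set D : ℝ := (b - a) * oneNorm u
  refine ⟨2 * C + 2 * D, fun n s hs t ht l₀ h => ?_⟩
  have hab : 0 ≤ b - a := by linarith [hs.1, hs.2]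
  have hD : 0 ≤ D := mul_nonneg hab (oneNorm_nonneg _)
  obtain ⟨hn₀, hl₀⟩ := h 0 (zero_mem_slabPoints _ n hs)
  simp only [zero_add, AddMonoidHom.coe_comp, LinearMap.toAddMonoidHom_coe,
    Function.comp_apply] at hn₀ hl₀
  set v := intIncl N l₀
  set e := v - f v • u
  have hfe : f e = 0 := by simp [e, hu]
  have hve : oneNorm (v - e) ≤ D := by
    have h1 : v - e = f v • u := by simp [e]
    rw [h1, oneNorm_smul]
    refine mul_le_mul_of_nonneg_right ?_ (oneNorm_nonneg _)
    rw [abs_le]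
    constructor <;> linarith [hl₀.1, hl₀.2, ht.1, ht.2]
  have hv : oneNorm v ≤ D + oneNorm e := by
    simpa using (oneNorm_add_le (v - e) e).trans (add_le_add_left hve _)
  rcases lt_or_ge (n : ℝ) C with hnC | hnC
  · linarith
  rcases (oneNorm_nonneg e).eq_or_lt with he | he
  · linarith
  set z := ((n - C) / oneNorm e) • e
  obtain ⟨l, hl, hsl⟩ := hC z (by simp [z, hfe]) s hs
  have hz : oneNorm z = n - C := by
    rw [oneNorm_smul, abs_of_nonneg (div_nonneg (sub_nonneg.2 hnC) he.le),
      div_mul_cancel₀ _ he.ne']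
  have hze : oneNorm (z + e) = n - C + oneNorm e := by
    have h1 : z + e = ((n - C) / oneNorm e + 1) • e := by rw [add_smul, one_smul]
    rw [h1, oneNorm_smul, abs_of_nonneg (by
      have := div_nonneg (sub_nonneg.2 hnC) he.le
      linarith), add_mul, div_mul_cancel₀ _ he.ne', one_mul]
  have hln : oneNorm (intIncl N l) ≤ n := by
    have h1 := oneNorm_add_le (intIncl N l - z) z
    rw [sub_add_cancel] at h1
    linarith
  have hsum := (h l ⟨hln, hsl⟩).1
  rw [map_add] at hsum
  have h1 : z + e = (intIncl N l + v) + (-(intIncl N l - z) + -(v - e)) := by abel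
  have h2 := oneNorm_add_le (intIncl N l + v) (-(intIncl N l - z) + -(v - e))
  have h3 := oneNorm_add_le (-(intIncl N l - z)) (-(v - e))
  rw [oneNorm_neg, oneNorm_neg] at h3
  rw [← h1, hze] at h2
  linarith

end Translation

section Coordinate

variable {N : ℕ}

/-- A linear coordinate on a one-dimensional internal space, in which the window is an interval. -/
lemma exists_internal_coordinate {E F : Submodule ℝ (Fin N → ℝ)} (hEF : IsCompl E F)
    (hFdim : Module.finrank ℝ F = 1)
    {K : Set (Fin N → ℝ)} (hKcompact : IsCompact K) (hKconv : Convex ℝ K)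
    (hKint : (interior ((↑) ⁻¹' K : Set F)).Nonempty)
    {πF : (Fin N → ℝ) →ₗ[ℝ] (Fin N → ℝ)}
    (hπFF : ∀ x ∈ F, πF x = x) (hπFE : ∀ x ∈ E, πF x = 0) :
    ∃ (f : (Fin N → ℝ) →ₗ[ℝ] ℝ) (u : Fin N → ℝ) (a b : ℝ), a < b ∧ u ∈ F ∧ f u = 1 ∧
      (∀ x ∈ E, f x = 0) ∧ (∀ x, πF x = f x • u) ∧ (∀ x ∈ F, x ∈ K ↔ f x ∈ Set.Icc a b) := by
  let c : F ≃L[ℝ] ℝ :=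
    (LinearEquiv.ofFinrankEq F ℝ (by simpa using hFdim)).toContinuousLinearEquiv
  have hmem : ∀ x, πF x ∈ F := fun x => by
    obtain ⟨e, he, y, hy, rfl⟩ := Submodule.mem_sup.1
      (hEF.sup_eq_top ▸ Submodule.mem_top : x ∈ E ⊔ F)
    rwa [map_add, hπFE e he, hπFF y hy, zero_add]
  let f : (Fin N → ℝ) →ₗ[ℝ] ℝ := c.toLinearEquiv.toLinearMap ∘ₗ πF.codRestrict F hmem
  have hf : ∀ x, f x = c ⟨πF x, hmem x⟩ := fun _ => rfl
  have hfF : ∀ y : F, f y = c y := fun y => by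
    rw [hf]
    congr 1
    exact Subtype.ext (hπFF y y.2)
  set K' : Set ℝ := c.symm ⁻¹' ((↑) ⁻¹' K : Set F) with hK'
  have hKF' : IsCompact ((↑) ⁻¹' K : Set F) :=
    (Submodule.closed_of_finiteDimensional F).isClosedEmbedding_subtypeVal.isCompact_preimage
      hKcompact
  have hK'comp : IsCompact K' := c.symm.toHomeomorph.isCompact_preimage.2 hKF'
  have hK'conv : Convex ℝ K' :=
    (hKconv.linear_preimage F.subtype).linear_preimage c.symm.toLinearEquiv.toLinearMap
  have hK'int : (interior K').Nonempty := by
    have h1 : interior K' = c.symm ⁻¹' interior ((↑) ⁻¹' K : Set F) :=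
      (c.symm.toHomeomorph.preimage_interior _).symm
    rw [h1]
    exact hKint.preimage c.symm.surjective
  have hK'Icc : K' = Set.Icc (sInf K') (sSup K') :=
    eq_Icc_of_connected_compact
      ⟨hK'int.mono interior_subset, hK'conv.isPreconnected⟩ hK'comp
  refine ⟨f, c.symm 1, sInf K', sSup K', ?_, (c.symm 1).2, by simp [hfF], fun x hx => ?_,
    fun x => ?_, fun x hx => ?_⟩
  · rw [hK'Icc, interior_Icc] at hK'int
    exact Set.nonempty_Ioo.1 hK'int
  · have h1 : (⟨πF x, hmem x⟩ : F) = 0 := Subtype.ext (hπFE x hx)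
    rw [hf, h1, map_zero]
  · have h1 : f x • c.symm 1 = (⟨πF x, hmem x⟩ : F) := by
      rw [← map_smul, smul_eq_mul, mul_one, hf, c.symm_apply_apply]
    exact (congrArg Subtype.val h1).symm
  · rw [← hK'Icc, hfF ⟨x, hx⟩]
    simp [hK']

lemma finrank_range_eq {πF : (Fin N → ℝ) →ₗ[ℝ] (Fin N → ℝ)} {f : (Fin N → ℝ) →ₗ[ℝ] ℝ}
    {u : Fin N → ℝ} (hu : u ≠ 0) (hπ : ∀ x, πF x = f x • u) :
    Module.finrank ℤ (f.toAddMonoidHom.comp (intIncl N)).range =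
      Module.finrank ℤ (AddSubgroup.closure (πF '' intLattice N)) := by
  set φ := f.toAddMonoidHom.comp (intIncl N)
  let g : ℝ →+ (Fin N → ℝ) := (LinearMap.toSpanSingleton ℝ _ u).toAddMonoidHom
  have hg : Function.Injective g := smul_left_injective ℝ hu
  have h1 : AddSubgroup.closure (πF '' intLattice N) = φ.range.map g := by
    have h2 : πF '' intLattice N = (φ.range.map g : Set (Fin N → ℝ)) := by
      ext y
      constructor
      · rintro ⟨_, ⟨m, rfl⟩, rfl⟩
        exact ⟨φ m, ⟨m, rfl⟩, (hπ _).symm⟩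
      · rintro ⟨_, ⟨m, rfl⟩, rfl⟩
        exact ⟨_, intIncl_mem_intLattice m, hπ _⟩
    rw [h2, AddSubgroup.closure_eq]
  rw [h1]
  exact (φ.range.equivMapOfInjective g hg).toIntLinearEquiv.finrank_eq

lemma exists_pos_lt_of_closure_eq {F : Submodule ℝ (Fin N → ℝ)}
    {πF : (Fin N → ℝ) →ₗ[ℝ] (Fin N → ℝ)} {f : (Fin N → ℝ) →ₗ[ℝ] ℝ}
    {u : Fin N → ℝ} (hu : u ∈ F) (hfu : f u = 1) (hπ : ∀ x, πF x = f x • u)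
    (hdense : closure (πF '' intLattice N) = (F : Set (Fin N → ℝ))) {w : ℝ} (hw : 0 < w) :
    ∃ g, 0 < f (intIncl N g) ∧ f (intIncl N g) < w := by
  have h1 : (w / 2) • u ∈ closure (πF '' intLattice N) := by
    rw [hdense]
    exact F.smul_mem _ hu
  have hopen : IsOpen (f ⁻¹' Set.Ioo 0 w) :=
    isOpen_Ioo.preimage f.continuous_of_finiteDimensional
  obtain ⟨_, hy, _, ⟨m, rfl⟩, rfl⟩ := mem_closure_iff.1 h1 _ hopen (by
    simp only [Set.mem_preimage, map_smul, hfu, smul_eq_mul, mul_one]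
    constructor <;> linarith)
  rw [Set.mem_preimage, hπ, map_smul, hfu, smul_eq_mul, mul_one] at hy
  exact ⟨m, hy⟩

lemma add_submodule_eq_preimage {E F : Submodule ℝ (Fin N → ℝ)} (hEF : IsCompl E F)
    {K : Set (Fin N → ℝ)} (hKF : K ⊆ (F : Set (Fin N → ℝ))) {f : (Fin N → ℝ) →ₗ[ℝ] ℝ} {a b : ℝ}
    (hfE : ∀ x ∈ E, f x = 0) (hK : ∀ x ∈ F, x ∈ K ↔ f x ∈ Set.Icc a b) :
    K + (E : Set (Fin N → ℝ)) = f ⁻¹' Set.Icc a b := by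
  ext y
  constructor
  · rintro ⟨x, hx, e, he, rfl⟩
    rw [Set.mem_preimage, map_add, hfE e he, add_zero]
    exact (hK x (hKF hx)).1 hx
  · intro hy
    obtain ⟨e, he, x, hx, rfl⟩ := Submodule.mem_sup.1
      (hEF.sup_eq_top ▸ Submodule.mem_top : y ∈ E ⊔ F)
    rw [Set.mem_preimage, map_add, hfE e he, zero_add] at hy
    exact ⟨x, (hK x hx).2 hy, e, he, add_comm _ _⟩

lemma frontier_preimage_Icc {f : (Fin N → ℝ) →ₗ[ℝ] ℝ} {u : Fin N → ℝ} (hfu : f u = 1) {a b : ℝ}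
    (hab : a ≤ b) : frontier (f ⁻¹' Set.Icc a b) = f ⁻¹' {a, b} := by
  have hcont : Continuous f := f.continuous_of_finiteDimensional
  have hsurj : Function.Surjective f := fun t => ⟨t • u, by simp [hfu]⟩
  have hopen : IsOpenMap f := (⟨f, hcont⟩ : (Fin N → ℝ) →L[ℝ] ℝ).isOpenMap hsurj
  rw [← hopen.preimage_frontier_eq_frontier_preimage hcont, frontier_Icc hab]

end Coordinate

section Patches

variable {N : ℕ}

lemma patchSet_eq_image_slabs {F : Submodule ℝ (Fin N → ℝ)} {K : Set (Fin N → ℝ)}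
    (hKF : K ⊆ (F : Set (Fin N → ℝ))) {π : (Fin N → ℝ) →ₗ[ℝ] (Fin N → ℝ)}
    (hπF : ∀ x ∈ F, π x = 0) {f : (Fin N → ℝ) →ₗ[ℝ] ℝ} {u : Fin N → ℝ} (hu : u ∈ F)
    (hfu : f u = 1) {a b : ℝ} (hab : a ≤ b) (hK : ∀ x ∈ F, x ∈ K ↔ f x ∈ Set.Icc a b)
    {S : Set (Fin N → ℝ)} (hS : S = f ⁻¹' Set.Icc a b) {Reg : ℕ → Set (Fin N → ℝ)}
    (hReg : ∀ n, Reg n =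
      {x ∈ S | ¬ ∃ l ∈ intLattice N, oneNorm l ≤ n ∧ x + l ∈ frontier S}) (n : ℕ) :
    patchSet π S K Reg n =
      (fun P => (π ∘ intIncl N) '' P) '' slabs (f.toAddMonoidHom.comp (intIncl N)) a b n := by
  have hpatch : ∀ x ∈ F, π '' liftedPatch S n x =
      (π ∘ intIncl N) '' slabPoints (f.toAddMonoidHom.comp (intIncl N)) a b n (f x) := by
    intro x hx
    ext q
    constructor
    · rintro ⟨y, ⟨⟨m, hm⟩, hyn, hyS⟩, rfl⟩
      change intIncl N m = y - x at hm
      rw [← hm] at hyn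
      have hy : y = x + intIncl N m := by rw [hm]; abel
      refine ⟨m, ⟨hyn, ?_⟩, ?_⟩
      · rw [hS, hy, Set.mem_preimage, map_add] at hyS
        exact hyS
      · rw [hy, map_add, hπF x hx, zero_add, Function.comp_apply]
    · rintro ⟨m, ⟨hm, hmS⟩, rfl⟩
      refine ⟨x + intIncl N m, ⟨?_, ?_, ?_⟩, ?_⟩
      · rw [add_sub_cancel_left]
        exact intIncl_mem_intLattice m
      · rwa [add_sub_cancel_left]
      · rw [hS, Set.mem_preimage, map_add]
        exact hmS
      · rw [map_add, hπF x hx, zero_add, Function.comp_apply]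
  have hreg : ∀ x ∈ F, x ∈ K ∩ Reg n ↔
      f x ∈ slabRegular (f.toAddMonoidHom.comp (intIncl N)) a b n := by
    intro x hx
    rw [Set.mem_inter_iff, hReg, hK x hx, hS, frontier_preimage_Icc hfu hab]
    constructor
    · rintro ⟨h1, -, h2⟩
      refine ⟨h1, ?_⟩
      rintro ⟨m, hm, h⟩
      exact h2 ⟨_, intIncl_mem_intLattice m, hm, by simpa using h⟩
    · rintro ⟨h1, h2⟩
      refine ⟨h1, h1, ?_⟩
      rintro ⟨_, ⟨m, rfl⟩, hm, h⟩
      rw [Set.mem_preimage, map_add] at h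
      exact h2 ⟨m, hm, h⟩
  ext P
  constructor
  · rintro ⟨x, hx, rfl⟩
    exact ⟨_, ⟨f x, (hreg x (hKF hx.1)).1 hx, rfl⟩, (hpatch x (hKF hx.1)).symm⟩
  · rintro ⟨_, ⟨s, hs, rfl⟩, rfl⟩
    have hsF : s • u ∈ F := F.smul_mem _ hu
    have hfs : f (s • u) = s := by simp [hfu]
    refine ⟨s • u, (hreg _ hsF).2 (hfs.symm ▸ hs), ?_⟩
    rw [hpatch _ hsF, hfs]

lemma card_le_mul_card_quot {X : Type*} [Finite X] {r : X → X → Prop} (hr : Equivalence r) {D : ℕ}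
    (h : ∀ x, {y | r x y}.ncard ≤ D) : Nat.card X ≤ D * Nat.card (Quot r) := by
  classical
  have := Fintype.ofFinite X
  have := Fintype.ofFinite (Quot r)
  rw [Nat.card_eq_fintype_card, Nat.card_eq_fintype_card]
  refine Finset.card_le_mul_card_image_of_maps_to (f := Quot.mk r)
    (fun _ _ => Finset.mem_univ _) D fun q _ => ?_
  induction q using Quot.ind with | mk x
  refine le_trans ?_ (h x)
  rw [← Set.ncard_coe_finset]
  refine Set.ncard_le_ncard (fun y hy => ?_) (Set.toFinite _)
  simp only [Finset.coe_filter, Finset.mem_univ, true_and, Set.mem_ofPred_eq] at hy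
  exact hr.symm (hr.eqvGen_iff.1 (Quot.eqvGen_exact hy))

lemma equivalence_translate {V : Type*} [AddCommGroup V] [Module ℝ V] (E : Submodule ℝ V)
    (X : Set (Set V)) :
    Equivalence (fun P Q : X => ∃ t ∈ E, ((· + t) '' (P : Set V)) = (Q : Set V)) where
  refl P := ⟨0, E.zero_mem, by simp⟩
  symm := by
    rintro P Q ⟨t, ht, h⟩
    refine ⟨-t, E.neg_mem ht, ?_⟩
    rw [← h, Set.image_image]
    simp
  trans := by
    rintro P Q R ⟨t, ht, h⟩ ⟨t', ht', h'⟩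
    refine ⟨t + t', E.add_mem ht ht', ?_⟩
    rw [← h', ← h, Set.image_image]
    simp [add_assoc]

/-- Each translation class of patches has boundedly many members, uniformly in the size. -/
lemma exists_card_slabs_le_mul_card_quot (E : Submodule ℝ (Fin N → ℝ))
    {π : (Fin N → ℝ) →ₗ[ℝ] (Fin N → ℝ)} (hπ : Set.InjOn π (intLattice N))
    (f : (Fin N → ℝ) →ₗ[ℝ] ℝ) {u : Fin N → ℝ} (hfu : f u = 1)
    {a b : ℝ} (hw : ∃ g, 0 < f (intIncl N g) ∧ f (intIncl N g) < b - a) :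
    ∃ D : ℕ, 0 < D ∧ ∀ (n : ℕ) (X : Set (Set (Fin N → ℝ))),
      X = (fun P => (π ∘ intIncl N) '' P) '' slabs (f.toAddMonoidHom.comp (intIncl N)) a b n →
      Nat.card (Quot (fun P Q : X => ∃ t ∈ E, ((· + t) '' (P : Set (Fin N → ℝ))) = Q)) ≤
        (slabs (f.toAddMonoidHom.comp (intIncl N)) a b n).ncard ∧
      (slabs (f.toAddMonoidHom.comp (intIncl N)) a b n).ncard ≤ D *
        Nat.card (Quot (fun P Q : X => ∃ t ∈ E, ((· + t) '' (P : Set (Fin N → ℝ))) = Q)) := by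
  have hinj : Function.Injective (π ∘ intIncl N) := fun m m' h =>
    intIncl_injective N (hπ (intIncl_mem_intLattice m) (intIncl_mem_intLattice m') h)
  obtain ⟨R, hR⟩ := exists_oneNorm_le_of_translate f hfu hw
  set φ := f.toAddMonoidHom.comp (intIncl N)
  set B := {m : Fin N → ℤ | oneNorm (intIncl N m) ≤ R}
  have hB : B.Finite := finite_intIncl_oneNorm_le R
  refine ⟨B.ncard + 1, Nat.succ_pos _, ?_⟩
  rintro n X rfl
  set X := (fun P => (π ∘ intIncl N) '' P) '' slabs φ a b n
  have hX : X.Finite := (finite_slabs_and_ncard_le φ n).1.image _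
  have hcard : Nat.card X = (slabs φ a b n).ncard := by
    rw [Nat.card_coe_set_eq, Set.ncard_image_of_injective _ hinj.image_injective]
  have := hX.to_subtype
  rw [← hcard]
  refine ⟨Nat.card_le_card_of_surjective _ Quot.mk_surjective,
    card_le_mul_card_quot (equivalence_translate E X) fun P => ?_⟩
  refine le_trans ?_ (Nat.le_succ _)
  rw [← Set.ncard_image_of_injective _ Subtype.val_injective]
  refine (Set.ncard_le_ncard (t := (fun l => (· + π (intIncl N l)) '' (P : Set (Fin N → ℝ))) '' B)
    ?_ (hB.image _)).trans (Set.ncard_image_le hB)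
  rintro _ ⟨Q, ⟨t, -, hQ⟩, rfl⟩
  obtain ⟨_, ⟨s, hs, rfl⟩, hP⟩ := P.2
  obtain ⟨_, ⟨s', hs', rfl⟩, hQ'⟩ := Q.2
  simp only at hP hQ'
  obtain ⟨l₀, -, hl₀⟩ : t ∈ (π ∘ intIncl N) '' slabPoints φ a b n s' := by
    rw [hQ', ← hQ, ← hP]
    exact ⟨0, ⟨0, zero_mem_slabPoints φ n hs.1, by simp⟩, zero_add t⟩
  refine ⟨l₀, hR n s hs.1 s' hs'.1 l₀ fun l hl => ?_, ?_⟩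
  · have h1 : (π ∘ intIncl N) (l + l₀) ∈ (Q : Set (Fin N → ℝ)) := by
      rw [← hQ, ← hP]
      exact ⟨_, ⟨l, hl, rfl⟩, by simp [← hl₀]⟩
    rw [← hQ'] at h1
    exact hinj.mem_set_image.1 h1
  · rw [← hQ, ← hl₀]
    rfl

end Patches

lemma one_le_ncard_ballValues_inter_Ioc {N : ℕ} (φ : (Fin N → ℤ) →+ ℝ) {w : ℝ} (hw : 0 < w)
    (n : ℕ) : 1 ≤ (ballValues φ n ∩ Set.Ioc (-w) 0).ncard := by
  refine (Set.ncard_pos ((finite_ballValues φ n).inter_of_left _)).2 ⟨0, ⟨0, ?_, map_zero φ⟩, ?_⟩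
  · rw [Set.mem_ofPred_eq, map_zero, oneNorm_zero]
    exact n.cast_nonneg
  · constructor <;> linarith

lemma ballValues_mono {N : ℕ} (φ : (Fin N → ℤ) →+ ℝ) : Monotone (ballValues φ) := fun _ _ h =>
  Set.image_mono fun m (hm : oneNorm (intIncl N m) ≤ _) => hm.trans (Nat.cast_le.2 h)

lemma exists_mul_pow_le_ncard_ballValues {N q : ℕ} (φ : (Fin N → ℤ) →+ ℝ)
    (hr : Module.finrank ℤ φ.range = q + 1) {w : ℝ} (hw : ∃ g, 0 < φ g ∧ φ g < w) :
    ∃ c : ℝ, 0 < c ∧ ∀ n : ℕ,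
      c * (n : ℝ) ^ q ≤ (ballValues φ n ∩ Set.Ioc (-w) 0).ncard := by
  obtain ⟨A, hA, h⟩ := exists_pow_le_ncard_ballValues_inter_Ioc φ hr hw
  have hA' : (0 : ℝ) < A := by exact_mod_cast hA
  refine ⟨(1 / (2 * A)) ^ q, by positivity, fun n => ?_⟩
  rw [← mul_pow]
  rcases lt_or_ge n A with hn | hn
  · obtain ⟨g, hg0, hgw⟩ := hw
    have h1 : (1 : ℝ) ≤ (ballValues φ n ∩ Set.Ioc (-w) 0).ncard := by
      exact_mod_cast one_le_ncard_ballValues_inter_Ioc φ (hg0.trans hgw) n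
    refine le_trans (pow_le_one₀ (by positivity) ?_) h1
    have h2 : (n : ℝ) ≤ A := by exact_mod_cast hn.le
    rw [one_div_mul_eq_div, div_le_one (by positivity)]
    linarith
  · have hM : 1 ≤ n / A := (Nat.one_le_div_iff hA).2 hn
    have hle : (n : ℝ) ≤ 2 * A * (n / A : ℕ) := by
      have h1 : n < A * (n / A) + A := Nat.lt_mul_div_succ n hA
      have h2 : n ≤ 2 * A * (n / A) := by nlinarith
      exact_mod_cast h2
    calc (1 / (2 * A) * (n : ℝ)) ^ q ≤ ((n / A : ℕ) : ℝ) ^ q := by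
          gcongr
          rw [one_div_mul_eq_div, div_le_iff₀ (by positivity)]
          linarith
      _ ≤ ((ballValues φ (A * (n / A)) ∩ Set.Ioc (-w) 0).ncard : ℝ) := by exact_mod_cast h _ hM
      _ ≤ _ := by
          have := Set.ncard_le_ncard
            (Set.inter_subset_inter_left (Set.Ioc (-w) 0) (ballValues_mono φ (Nat.mul_div_le n A)))
            ((finite_ballValues φ n).inter_of_left _)
          exact_mod_cast this

/-- Discrete hyperplanes: for an `(N, N-1)` cut-and-projection method (internal space
`F` of dimension one) with `Γ = π_F(ℤ^N)` dense of rank `N - k`, the complexity grows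
like `n^(N-1-k)` up to multiplicative constants. -/
theorem stmt17 (N k : ℕ) (hkN : k < N)
    (E F : Submodule ℝ (Fin N → ℝ)) (hEF : IsCompl E F)
    (hFdim : Module.finrank ℝ F = 1)
    (K : Set (Fin N → ℝ)) (hKF : K ⊆ (F : Set (Fin N → ℝ)))
    (hKcompact : IsCompact K) (hKconv : Convex ℝ K)
    (hKint : (interior ((↑) ⁻¹' K : Set F)).Nonempty)
    (π πF : (Fin N → ℝ) →ₗ[ℝ] (Fin N → ℝ))
    (hπE : ∀ x ∈ E, π x = x) (hπF : ∀ x ∈ F, π x = 0)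
    (hπFF : ∀ x ∈ F, πF x = x) (hπFE : ∀ x ∈ E, πF x = 0)
    (hπinj : Set.InjOn π (intLattice N))
    (hdense : closure (πF '' intLattice N) = (F : Set (Fin N → ℝ)))
    (hrank : Module.finrank ℤ
      ↥(AddSubgroup.closure (πF '' intLattice N)) = N - k)
    (S : Set (Fin N → ℝ)) (hS : S = K + (E : Set (Fin N → ℝ)))
    (Reg : ℕ → Set (Fin N → ℝ))
    (hReg : ∀ n, Reg n =
      {x ∈ S | ¬ ∃ l ∈ intLattice N, oneNorm l ≤ n ∧ x + l ∈ frontier S})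
    (p : ℕ → ℕ)
    (hp : ∀ n, p n = Nat.card (Quot (fun P Q : patchSet π S K Reg n =>
      ∃ t ∈ E, ((· + t) '' (P : Set (Fin N → ℝ))) = (Q : Set (Fin N → ℝ))))) :
    ∃ C₁ C₂ : ℝ, 0 < C₁ ∧ 0 < C₂ ∧ ∀ n : ℕ, 1 ≤ n →
      C₁ * (n : ℝ) ^ (N - 1 - k) ≤ (p n : ℝ) ∧
      (p n : ℝ) ≤ C₂ * (n : ℝ) ^ (N - 1 - k) := by
  obtain ⟨f, u, a, b, hab, huF, hfu, hfE, hπu, hK⟩ :=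
    exists_internal_coordinate hEF hFdim hKcompact hKconv hKint hπFF hπFE
  have hu : u ≠ 0 := by
    rintro rfl
    simp at hfu
  have hw := exists_pos_lt_of_closure_eq huF hfu hπu hdense (sub_pos.2 hab)
  have hS' : S = f ⁻¹' Set.Icc a b := by rw [hS, add_submodule_eq_preimage hEF hKF hfE hK]
  have hpatch := patchSet_eq_image_slabs hKF hπF huF hfu hab.le hK hS' hReg
  obtain ⟨D, hD, hcard⟩ := exists_card_slabs_le_mul_card_quot E hπinj f hfu hw
  have hr := finrank_range_eq hu hπu
  set φ := f.toAddMonoidHom.comp (intIncl N)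
  rw [hrank, show N - k = N - 1 - k + 1 by omega] at hr
  obtain ⟨C, hC⟩ := ncard_ballValues_inter_Ioo_le φ hr (b - a)
  obtain ⟨c, hc0, hc⟩ := exists_mul_pow_le_ncard_ballValues φ hr hw
  have hD' : (0 : ℝ) < D := by exact_mod_cast hD
  refine ⟨c / D, 2 * C + 1, by positivity, by positivity, fun n hn => ?_⟩
  obtain ⟨hle, hge⟩ := hcard n _ (hpatch n)
  rw [← hp n] at hle hge
  constructor
  · rw [div_mul_eq_mul_div, div_le_iff₀ hD', mul_comm (p n : ℝ)]
    have h1 := (ncard_ballValues_inter_Ioc_le_ncard_slabs φ n (a := a) (b := b)).trans hge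
    exact (hc n).trans (by exact_mod_cast h1)
  · have h1 := (finite_slabs_and_ncard_le φ n (a := a) (b := b)).2
    have h2 := ncard_slabThresholds_inter_Ioo_le φ n (a := a) (b := b)
    have h3 := hC n hn
    have h4 : 1 ≤ n ^ (N - 1 - k) := Nat.one_le_pow _ _ hn
    have h5 : p n ≤ (2 * C + 1) * n ^ (N - 1 - k) := by linarith
    exact_mod_cast h5
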